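/- arXiv:2409.03897 — 2 statements merged into one kernel-verified Lean document; each statement's English description precedes it below -/
import Mathlib

section
/- Fix an agent k ∈ {1,…,K}, a time i ≥ 0, and a constant B ≥ 0. Suppose that for every i' with χ(i) < i' ≤ i one has ‖γλ ∑_{j=χ(i)}^{i'−1} (1−λ)^{i'−1−j} (P̄ − P̃_j^k)V*‖∞ ≤ B. Then ‖Δ_i^k‖∞ ≤ (1 − (1−γ)λ)^{i−χ(i)} ‖Δ_{χ(i)}‖∞ + (1 + γλ)^{i−χ(i)} B. -/
open Finset

/-- Entrywise sup norm of a function on a finite nonempty index set. -/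
noncomputable def supNorm {ι : Type*} [Fintype ι] [Nonempty ι] (f : ι → ℝ) : ℝ :=
  ⨆ i, |f i|

theorem abs_le_supNorm {ι : Type*} [Fintype ι] [Nonempty ι] (f : ι → ℝ) (x : ι) :
    |f x| ≤ supNorm f :=
  le_ciSup (f := fun i => |f i|) (Set.finite_range _).bddAbove x

theorem supNorm_le {ι : Type*} [Fintype ι] [Nonempty ι] {f : ι → ℝ} {d : ℝ}
    (h : ∀ x, |f x| ≤ d) : supNorm f ≤ d :=
  ciSup_le h

theorem ciSup_le_ciSup_add {ι : Type*} [Finite ι] [Nonempty ι] {f g : ι → ℝ} {d : ℝ}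
    (h : ∀ x, f x ≤ g x + d) : ⨆ x, f x ≤ (⨆ x, g x) + d :=
  ciSup_le fun x => (h x).trans <| by
    gcongr
    exact le_ciSup (Set.finite_range g).bddAbove x

/-- The supremum over a finite set is nonexpansive in the sup norm. -/
theorem abs_ciSup_sub_ciSup_le {ι : Type*} [Finite ι] [Nonempty ι] {f g : ι → ℝ} {d : ℝ}
    (h : ∀ x, |f x - g x| ≤ d) : |(⨆ x, f x) - ⨆ x, g x| ≤ d := by
  have h₁ : ⨆ x, f x ≤ (⨆ x, g x) + d :=
    ciSup_le_ciSup_add fun x => by linarith [(abs_le.mp (h x)).2]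
  have h₂ : ⨆ x, g x ≤ (⨆ x, f x) + d :=
    ciSup_le_ciSup_add fun x => by linarith [(abs_le.mp (h x)).1]
  exact abs_le.mpr ⟨by linarith, by linarith⟩

/-- A geometrically discounted sum satisfies a one-step linear recursion. -/
theorem sum_Ico_discounted_succ (r : ℝ) (f : ℕ → ℝ) (c n : ℕ) :
    ∑ j ∈ Ico c (c + (n + 1)), r ^ (c + (n + 1) - 1 - j) * f j
      = r * ∑ j ∈ Ico c (c + n), r ^ (c + n - 1 - j) * f j + f (c + n) := by
  rw [← add_assoc, sum_Ico_succ_top (by omega), mul_sum]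
  congr 1
  · refine sum_congr rfl fun j hj => ?_
    have hj' := mem_Ico.mp hj
    rw [show c + n + 1 - 1 - j = (c + n - 1 - j) + 1 by omega, pow_succ]
    ring
  · simp

/-- One step of the recursion for the error after subtracting the accumulated noise. -/
theorem residual_bound_succ {γ lam B D X : ℝ} {n : ℕ}
    (hγ : γ ∈ Set.Ioo (0 : ℝ) 1) (hlam : lam ∈ Set.Ioc (0 : ℝ) 1) (hB : 0 ≤ B)
    (hX : X ≤ (1 - (1 - γ) * lam) ^ n * D + ((1 + γ * lam) ^ n - 1) * B) :
    (1 - lam) * X + γ * lam * (X + B)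
      ≤ (1 - (1 - γ) * lam) ^ (n + 1) * D + ((1 + γ * lam) ^ (n + 1) - 1) * B := by
  obtain ⟨hγ0, hγ1⟩ := hγ
  obtain ⟨hl0, hl1⟩ := hlam
  have hγl : 0 < γ * lam := mul_pos hγ0 hl0
  have ha : 0 ≤ 1 - (1 - γ) * lam := by linarith
  have hb : 0 ≤ (1 + γ * lam) ^ n - 1 :=
    sub_nonneg.mpr (one_le_pow₀ (by linarith))
  have h₁ := mul_le_mul_of_nonneg_left hX ha
  have h₂ : 0 ≤ lam * (((1 + γ * lam) ^ n - 1) * B) := by positivity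
  rw [pow_succ, pow_succ]
  linarith

/-- Fix an agent `k`, a time `i`, and a constant `B ≥ 0`. If for every `i'` with
`χ(i) < i' ≤ i` one has `‖γλ ∑_{j=χ(i)}^{i'−1} (1−λ)^{i'−1−j} (P̄ − P̃_j^k)V*‖∞ ≤ B`, then
`‖Δ_i^k‖∞ ≤ (1 − (1−γ)λ)^{i−χ(i)} ‖Δ_{χ(i)}‖∞ + (1 + γλ)^{i−χ(i)} B`. -/
theorem local_error_within_round
    {S A : Type*} [Fintype S] [Nonempty S] [DecidableEq S] [Fintype A] [Nonempty A]
    (γ lam : ℝ) (hγ : γ ∈ Set.Ioo (0:ℝ) 1) (hlam : lam ∈ Set.Ioc (0:ℝ) 1)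
    (K : ℕ) (hK : 1 ≤ K) (E : ℕ) (hE : 1 ≤ E)
    (R : S × A → ℝ) (hR : ∀ p, R p ∈ Set.Icc (0:ℝ) 1)
    (P : Fin K → S × A → S → ℝ)
    (hPnn : ∀ k p s', 0 ≤ P k p s') (hPsum : ∀ k p, ∑ s', P k p s' = 1)
    (Pbar : S × A → S → ℝ)
    (hPbar : ∀ p s', Pbar p s' = (∑ k, P k p s') / K)
    (Qstar : S × A → ℝ)
    (hQstar : ∀ p, Qstar p = R p + γ * ∑ s', Pbar p s' * (⨆ a, Qstar (s', a)))
    (Vstar : S → ℝ) (hVstar : ∀ s, Vstar s = ⨆ a, Qstar (s, a))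
    (Ptil : ℕ → Fin K → S × A → S → ℝ)
    (hPtil : ∀ t k p, ∃ s', ∀ s'', Ptil t k p s'' = if s'' = s' then 1 else 0)
    (Q0 : S × A → ℝ)
    (Q : ℕ → Fin K → S × A → ℝ)
    (hQ0 : ∀ k, Q 0 k = Q0)
    (hQrec : ∀ t k p,
      Q (t+1) k p =
        if (t+1) % E = 0 then
          (∑ j, ((1 - lam) * Q t j p
            + lam * (R p + γ * ∑ s', Ptil t j p s' * (⨆ a, Q t j (s', a))))) / K
        else
          (1 - lam) * Q t k p
            + lam * (R p + γ * ∑ s', Ptil t k p s' * (⨆ a, Q t k (s', a))))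
    (k : Fin K) (i : ℕ) (B : ℝ) (hB : 0 ≤ B)
    (hnoise : ∀ i', i - i % E < i' → i' ≤ i →
      supNorm (fun p => γ * lam * ∑ j ∈ Finset.Ico (i - i % E) i',
          (1 - lam) ^ (i' - 1 - j) *
            ((∑ s', Pbar p s' * Vstar s') - ∑ s', Ptil j k p s' * Vstar s')) ≤ B) :
    supNorm (fun p => Qstar p - Q i k p)
      ≤ (1 - (1 - γ) * lam) ^ (i - (i - i % E)) *
          supNorm (fun p => Qstar p - (∑ j, Q (i - i % E) j p) / K)
        + (1 + γ * lam) ^ (i - (i - i % E)) * B := by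
  have hmod : i % E < E := Nat.mod_lt _ hE
  have hle : i % E ≤ i := Nat.mod_le _ _
  have hc : (i - i % E) % E = 0 := Nat.sub_mod_eq_zero_of_mod_eq (Nat.mod_mod _ _).symm
  generalize hcdef : i - i % E = c at *
  have hsync : ∀ j, Q c j = Q c k := by
    intro j
    cases c with
    | zero => rw [hQ0, hQ0]
    | succ t => funext p; rw [hQrec, hQrec, if_pos hc, if_pos hc]
  have hK0 : (K : ℝ) ≠ 0 := by positivity
  have havg : (fun p => Qstar p - (∑ j, Q c j p) / K) = fun p => Qstar p - Q c k p := by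
    funext p
    simp [hsync, mul_div_cancel_left₀ _ hK0]
  rw [havg]
  set D := supNorm fun p => Qstar p - Q c k p
  set noise : ℕ → S × A → ℝ := fun j p =>
    (∑ s', Pbar p s' * Vstar s') - ∑ s', Ptil j k p s' * Vstar s' with hnoise_def
  set N : ℕ → S × A → ℝ := fun n p =>
    γ * lam * ∑ j ∈ Ico c (c + n), (1 - lam) ^ (c + n - 1 - j) * noise j p with hN
  have hN_le : ∀ n, c + n ≤ i → ∀ p, |N n p| ≤ B := by
    intro n hn p
    rcases Nat.eq_zero_or_pos n with rfl | hpos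
    · simpa [hN] using hB
    · exact (abs_le_supNorm (N n) p).trans (hnoise (c + n) (by omega) hn)
  have hN_succ : ∀ n p, N (n + 1) p = (1 - lam) * N n p + γ * lam * noise (c + n) p := by
    intro n p
    simp only [hN, sum_Ico_discounted_succ (1 - lam) (fun j => noise j p)]
    ring
  have hlocal : ∀ n, c + (n + 1) ≤ i → (c + n + 1) % E ≠ 0 := by
    intro n hn
    rw [add_assoc, Nat.add_mod, hc, zero_add, Nat.mod_mod, Nat.mod_eq_of_lt (by omega)]
    omega
  have residual : ∀ n, c + n ≤ i → ∀ p, |Qstar p - Q (c + n) k p - N n p|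
      ≤ (1 - (1 - γ) * lam) ^ n * D + ((1 + γ * lam) ^ n - 1) * B := by
    intro n
    induction n with
    | zero =>
      intro _ p
      simpa [hN] using abs_le_supNorm (fun p => Qstar p - Q c k p) p
    | succ n ih =>
      intro hn p
      have ih := ih (by omega)
      refine le_trans ?_ (residual_bound_succ (n := n) hγ hlam hB le_rfl)
      set X := (1 - (1 - γ) * lam) ^ n * D + ((1 + γ * lam) ^ n - 1) * B
      have hΔ : ∀ q, |Qstar q - Q (c + n) k q| ≤ X + B := fun q => by
        have := abs_add_le (Qstar q - Q (c + n) k q - N n q) (N n q)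
        rw [sub_add_cancel] at this
        linarith [ih q, hN_le n (by omega) q]
      obtain ⟨s, hs⟩ := hPtil (c + n) k p
      have hsum : ∀ V : S → ℝ, ∑ s', Ptil (c + n) k p s' * V s' = V s := by
        intro V
        simp [hs]
      have hstep : Qstar p - Q (c + (n + 1)) k p - N (n + 1) p
          = (1 - lam) * (Qstar p - Q (c + n) k p - N n p)
            + γ * lam * ((⨆ a, Qstar (s, a)) - ⨆ a, Q (c + n) k (s, a)) := by
        rw [hN_succ, ← add_assoc, hQrec, if_neg (hlocal n hn)]
        simp only [hnoise_def, hsum, hVstar]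
        linear_combination lam * hQstar p
      rw [hstep]
      refine (abs_add_le _ _).trans ?_
      rw [abs_mul, abs_mul, abs_of_nonneg (sub_nonneg.mpr hlam.2),
        abs_of_pos (mul_pos hγ.1 hlam.1)]
      gcongr
      · exact sub_nonneg.mpr hlam.2
      · exact ih p
      · exact (mul_pos hγ.1 hlam.1).le
      · exact abs_ciSup_sub_ciSup_le fun a => hΔ (s, a)
  refine supNorm_le fun p => ?_
  have hci : c + (i - c) = i := by omega
  have h₁ := residual (i - c) hci.le p
  have h₂ := hN_le (i - c) hci.le p
  rw [hci] at h₁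
  have h₃ := abs_add_le (Qstar p - Q i k p - N (i - c) p) (N (i - c) p)
  rw [sub_add_cancel] at h₃
  linarith
end

section
/- In the two-state construction, for every E ≥ 1 the residual matrix satisfies (I − Ā^{(E)}) − (I + Ā^{(1)} + ⋯ + Ā^{(E−1)})(I − Ā^{(1)}) = κ_E (I − P̄), where κ_E = −(γ/2)·((1−ν₂^E)/(1−γ) − (1−ν₁^E)/(1+γ)) with ν₁ = 1−(1+γ)λ and ν₂ = 1−(1−γ)λ. -/
open Finset Matrix

/-- A sum over `Fin (m + m)` of a parity-dependent summand. -/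
theorem sum_fin_add_self_ite_even {M : Type*} [AddCommMonoid M] (a b : M) (m : ℕ) :
    ∑ k : Fin (m + m), (if (k : ℕ) % 2 = 0 then a else b) = m • (a + b) := by
  rw [Fin.sum_univ_eq_sum_range (fun k => if k % 2 = 0 then a else b)]
  induction m with
  | zero => simp
  | succ m ih =>
    have h : m + 1 + (m + 1) = m + m + 1 + 1 := by ring
    have h₀ : (m + m) % 2 = 0 := by lia
    have h₁ : ¬ (m + m + 1) % 2 = 0 := by lia
    rw [h, sum_range_succ, sum_range_succ, ih, if_pos h₀, if_neg h₁, succ_nsmul, add_assoc]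

theorem inv_smul_sum_fin_ite_even {M : Type*} [AddCommGroup M] [Module ℝ M] (a b : M)
    {K : ℕ} (hK : K ≠ 0) (hKeven : Even K) :
    (K : ℝ)⁻¹ • ∑ k : Fin K, (if (k : ℕ) % 2 = 0 then a else b) = (2⁻¹ : ℝ) • (a + b) := by
  obtain ⟨m, rfl⟩ := hKeven
  have hm : (m : ℝ) ≠ 0 := by
    norm_cast
    lia
  rw [sum_fin_add_self_ite_even, ← Nat.cast_smul_eq_nsmul ℝ, smul_smul]
  congr 1
  push_cast
  field_simp
  norm_num

/-- Powers of a symmetric `2 × 2` circulant matrix, in terms of its eigenvalues. -/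
theorem symm_circulant_two_pow (x y : ℝ) (n : ℕ) :
    (!![(x + y) / 2, (x - y) / 2; (x - y) / 2, (x + y) / 2] : Matrix (Fin 2) (Fin 2) ℝ) ^ n =
      !![(x ^ n + y ^ n) / 2, (x ^ n - y ^ n) / 2; (x ^ n - y ^ n) / 2, (x ^ n + y ^ n) / 2] := by
  induction n with
  | zero => ext i j; fin_cases i <;> fin_cases j <;> simp
  | succ n ih =>
    rw [pow_succ, ih]
    ext i j
    fin_cases i <;> fin_cases j <;> simp [Matrix.mul_apply, Fin.sum_univ_two] <;> ring

/-- **Residual matrix in the two-state construction.** For every `E ≥ 1`,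
`(I − Ā^{(E)}) − (I + Ā^{(1)} + ⋯ + Ā^{(E−1)})(I − Ā^{(1)}) = κ_E (I − P̄)`, where
`κ_E = −(γ/2)((1−ν₂^E)/(1−γ) − (1−ν₁^E)/(1+γ))`, `ν₁ = 1−(1+γ)λ`, `ν₂ = 1−(1−γ)λ`. -/
theorem residual_matrix_two_state
    (γ lam : ℝ) (hγ : γ ∈ Set.Ioo (0:ℝ) 1) (hlam : lam ∈ Set.Ioc (0:ℝ) (1 / (1 + γ)))
    (K : ℕ) (hK : 2 ≤ K) (hKeven : Even K)
    (P : Fin K → Matrix (Fin 2) (Fin 2) ℝ)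
    (hP : ∀ k : Fin K, P k =
      if (k : ℕ) % 2 = 0 then (1 : Matrix (Fin 2) (Fin 2) ℝ) else !![0, 1; 1, 0])
    (Pbar : Matrix (Fin 2) (Fin 2) ℝ) (hPbar : Pbar = ((K : ℝ)⁻¹) • ∑ k, P k)
    (A : Fin K → Matrix (Fin 2) (Fin 2) ℝ)
    (hA : ∀ k, A k = (1 - lam) • (1 : Matrix (Fin 2) (Fin 2) ℝ) + (lam * γ) • P k)
    (Abar : ℕ → Matrix (Fin 2) (Fin 2) ℝ)
    (hAbar : ∀ ℓ, Abar ℓ = ((K : ℝ)⁻¹) • ∑ k, (A k) ^ ℓ) :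
    ∀ E : ℕ, 1 ≤ E →
      ((1 : Matrix (Fin 2) (Fin 2) ℝ) - Abar E)
          - (∑ ℓ ∈ Finset.range E, Abar ℓ) * ((1 : Matrix (Fin 2) (Fin 2) ℝ) - Abar 1)
        = (-(γ / 2) * ((1 - (1 - (1 - γ) * lam) ^ E) / (1 - γ)
              - (1 - (1 - (1 + γ) * lam) ^ E) / (1 + γ))) •
            ((1 : Matrix (Fin 2) (Fin 2) ℝ) - Pbar) := by
  have hK0 : K ≠ 0 := by lia
  have hPbar' : Pbar = !![1 / 2, 1 / 2; 1 / 2, 1 / 2] := by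
    simp only [hPbar, hP]
    rw [inv_smul_sum_fin_ite_even _ _ hK0 hKeven]
    ext i j
    fin_cases i <;> fin_cases j <;> simp
  set x := 1 - (1 - γ) * lam with hx
  set y := 1 - (1 + γ) * lam with hy
  have hA_even : (1 - lam) • (1 : Matrix (Fin 2) (Fin 2) ℝ) + (lam * γ) • 1 =
      !![(x + x) / 2, (x - x) / 2; (x - x) / 2, (x + x) / 2] := by
    ext i j
    fin_cases i <;> fin_cases j <;> simp [hx] <;> ring
  have hA_odd : (1 - lam) • (1 : Matrix (Fin 2) (Fin 2) ℝ) + (lam * γ) • !![0, 1; 1, 0] =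
      !![(x + y) / 2, (x - y) / 2; (x - y) / 2, (x + y) / 2] := by
    ext i j
    fin_cases i <;> fin_cases j <;> simp [hx, hy] <;> ring
  have hAbar' (ℓ : ℕ) : Abar ℓ =
      !![(3 * x ^ ℓ + y ^ ℓ) / 4, (x ^ ℓ - y ^ ℓ) / 4;
        (x ^ ℓ - y ^ ℓ) / 4, (3 * x ^ ℓ + y ^ ℓ) / 4] := by
    have hpow (k : Fin K) : A k ^ ℓ = if (k : ℕ) % 2 = 0
        then !![(x + x) / 2, (x - x) / 2; (x - x) / 2, (x + x) / 2] ^ ℓ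
        else !![(x + y) / 2, (x - y) / 2; (x - y) / 2, (x + y) / 2] ^ ℓ := by
      rw [hA, hP]
      split_ifs
      · rw [hA_even]
      · rw [hA_odd]
    simp only [hAbar, hpow]
    rw [inv_smul_sum_fin_ite_even _ _ hK0 hKeven, symm_circulant_two_pow, symm_circulant_two_pow]
    ext i j
    fin_cases i <;> fin_cases j <;> simp <;> ring
  have h₁ : 1 - γ ≠ 0 := by linarith [hγ.2]
  have h₂ : 1 + γ ≠ 0 := by linarith [hγ.1]
  suffices h : ∀ E : ℕ, (1 - Abar E) - (∑ ℓ ∈ Finset.range E, Abar ℓ) * (1 - Abar 1) =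
      (-(γ / 2) * ((1 - x ^ E) / (1 - γ) - (1 - y ^ E) / (1 + γ))) • (1 - Pbar) from
    fun E _ => h E
  intro E
  induction E with
  | zero =>
    ext i j
    fin_cases i <;> fin_cases j <;> simp [hAbar'] <;> norm_num
  | succ E ih =>
    have hstep : (1 - Abar (E + 1)) - (∑ ℓ ∈ Finset.range (E + 1), Abar ℓ) * (1 - Abar 1) =
        ((1 - Abar E) - (∑ ℓ ∈ Finset.range E, Abar ℓ) * (1 - Abar 1)) +
          (Abar E * Abar 1 - Abar (E + 1)) := by
      rw [sum_range_succ]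
      noncomm_ring
    rw [hstep, ih, hAbar', hAbar', hAbar', hPbar']
    ext i j
    fin_cases i <;> fin_cases j <;>
      simp [pow_succ] <;>
      generalize x ^ E = u <;> generalize y ^ E = v <;>
      rw [hx, hy] <;> field_simp <;> ring
end
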